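/- Under the setup below, the Taylor coefficients ϖ_k = G^{(k)}(0)/k! of G(y) = g(x(y))·x'(y) satisfy |ϖ_k| ≤ C·U( 1/N^k + 1/M^k ) for 1 ≤ k ≤ 2n, with C depending only on n and C_0, …, C_{2n+3}. -/

import Mathlib

open Set Filter Topology

lemma wsp_avg_hasDeriv (φ : ℝ → ℝ) (hφ : ContDiff ℝ 1 φ) (j : ℕ) (u : ℝ) :
    HasDerivAt (fun u => ∫ t in (0:ℝ)..1, t ^ j * φ (t * u))
      (∫ t in (0:ℝ)..1, t ^ (j + 1) * deriv φ (t * u)) u := by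
  have hd : Continuous (deriv φ) := hφ.continuous_deriv_one
  have hc : Continuous φ := hφ.continuous
  obtain ⟨B, hB⟩ : ∃ B, ∀ x ∈ Icc (-(|u| + 1)) (|u| + 1), ‖deriv φ x‖ ≤ B :=
    isCompact_Icc.exists_bound_of_continuousOn hd.continuousOn
  refine (intervalIntegral.hasDerivAt_integral_of_dominated_loc_of_deriv_le
    (F := fun u t => t ^ j * φ (t * u)) (F' := fun u t => t ^ (j + 1) * deriv φ (t * u))
    (bound := fun _ => B) (s := Icc (u - 1) (u + 1)) ?_ ?_ ?_ ?_ ?_ ?_ ?_).2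
  · exact Icc_mem_nhds (by linarith) (by linarith)
  · exact Eventually.of_forall fun x => (by fun_prop : Continuous _).aestronglyMeasurable
  · exact (by fun_prop : Continuous _).intervalIntegrable _ _
  · exact (by fun_prop : Continuous _).aestronglyMeasurable
  · refine Eventually.of_forall fun t ht x hx => ?_
    rw [uIoc_of_le zero_le_one] at ht
    have h1 : |t ^ (j + 1)| ≤ 1 := by
      rw [abs_of_nonneg (pow_nonneg ht.1.le _)]
      exact pow_le_one₀ ht.1.le ht.2
    have hx' : |x| ≤ |u| + 1 := by
      have h4 : |x - u| ≤ 1 := abs_le.2 ⟨by linarith [hx.1] , by linarith [hx.2]⟩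
      have := abs_add_le (x - u) u
      simp at this; linarith
    have h2 : t * x ∈ Icc (-(|u| + 1)) (|u| + 1) := by
      rw [mem_Icc, ← abs_le, abs_mul, abs_of_pos ht.1]
      nlinarith [abs_nonneg x, ht.2]
    have h3 := hB _ h2
    rw [norm_mul, Real.norm_eq_abs]
    calc _ ≤ 1 * ‖deriv φ (t * x)‖ := by gcongr
      _ ≤ B := by simpa using h3
  · exact intervalIntegrable_const
  · refine Eventually.of_forall fun t ht x hx => ?_
    have h1 : HasDerivAt φ (deriv φ (t * x)) (t * x) :=
      (hφ.differentiable (by norm_num) _).hasDerivAt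
    have h2 : HasDerivAt (fun x => t * x) t x := by simpa using (hasDerivAt_id x).const_mul t
    have := (h1.comp x h2).const_mul (t ^ j)
    refine this.congr_deriv ?_
    rw [pow_succ]; ring

lemma wsp_avg_contDiff (m : ℕ) : ∀ (φ : ℝ → ℝ) (_ : ContDiff ℝ m φ) (j : ℕ),
    ContDiff ℝ m (fun u => ∫ t in (0:ℝ)..1, t ^ j * φ (t * u)) := by
  induction m with
  | zero =>
    intro φ hφ j
    have hc : Continuous φ := hφ.continuous
    simp only [Nat.cast_zero, contDiff_zero]
    apply intervalIntegral.continuous_parametric_intervalIntegral_of_continuous'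
    fun_prop
  | succ m ih =>
    intro φ hφ j
    have h1 : ContDiff ℝ 1 φ := hφ.of_le (by norm_cast; omega)
    have hd := wsp_avg_hasDeriv φ h1 j
    push_cast at hφ ⊢
    rw [contDiff_succ_iff_deriv] at hφ ⊢
    refine ⟨fun u => (hd u).differentiableAt, by simp, ?_⟩
    have : deriv (fun u => ∫ t in (0:ℝ)..1, t ^ j * φ (t * u)) =
      fun u => ∫ t in (0:ℝ)..1, t ^ (j + 1) * deriv φ (t * u) := funext fun u => (hd u).deriv
    rw [this]
    exact ih _ hφ.2.2 _

lemma wsp_globalize (m : ℕ) (φ : ℝ → ℝ) (h : ContDiffAt ℝ m φ 0) :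
    ∃ ψ : ℝ → ℝ, ContDiff ℝ m ψ ∧ ψ =ᶠ[𝓝 0] φ := by
  have he := h.eventually (by simp)
  obtain ⟨r, hr, hb⟩ := Metric.eventually_nhds_iff_ball.1 he
  let b : ContDiffBump (0:ℝ) := ⟨r / 4, r / 2, by linarith, by linarith⟩
  refine ⟨fun x => b x * φ x, ?_, ?_⟩
  · rw [contDiff_iff_contDiffAt]
    intro x
    by_cases hx' : x ∈ tsupport b
    · rw [b.tsupport_eq] at hx'
      have : x ∈ Metric.ball (0:ℝ) r := Metric.closedBall_subset_ball (by simp [b]; linarith) hx'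
      exact b.contDiffAt.mul (hb x this)
    · have h0 : b =ᶠ[𝓝 x] 0 := notMem_tsupport_iff_eventuallyEq.1 hx'
      refine (contDiffAt_const (c := (0:ℝ))).congr_of_eventuallyEq ?_
      filter_upwards [h0] with y hy
      simp [hy]
  · filter_upwards [b.eventuallyEq_one] with x hx
    simp [hx]

/-- Hadamard division lemma. -/
lemma wsp_hadamard (m : ℕ) (F : ℝ → ℝ) (hF : ContDiffAt ℝ (m + 1 : ℕ) F 0) (h0 : F 0 = 0) :
    ∃ p : ℝ → ℝ, ContDiffAt ℝ m p 0 ∧ F =ᶠ[𝓝 0] fun u => u * p u := by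
  obtain ⟨ψ, hψ, he⟩ := wsp_globalize _ F hF
  push_cast at hψ
  have hdiff := (contDiff_succ_iff_deriv.1 hψ).1
  have hψ' := (contDiff_succ_iff_deriv.1 hψ).2.2
  refine ⟨_, (wsp_avg_contDiff m _ hψ' 0).contDiffAt, ?_⟩
  filter_upwards [he] with u hu
  rw [← hu]
  have hψ0 : ψ 0 = 0 := by rw [he.self_of_nhds, h0]
  have hc : Continuous (deriv ψ) := hψ'.continuous
  have : ∫ t in (0:ℝ)..1, deriv ψ (t * u) * u = ψ (1 * u) - ψ (0 * u) := by
    apply intervalIntegral.integral_eq_sub_of_hasDerivAt (f := fun t => ψ (t * u))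
    · intro t _
      have h2 : HasDerivAt (fun x => x * u) u t := by simpa using (hasDerivAt_id t).mul_const u
      exact (hdiff (t * u)).hasDerivAt.comp t h2
    · exact (by fun_prop : Continuous _).intervalIntegrable _ _
  rw [intervalIntegral.integral_mul_const] at this
  simp [hψ0] at this
  simp [← this, mul_comm]

/-- `F` is `C^m` at `x` and its derivatives at `x` up to order `m` are at most `K`. -/
def WspBd (m : ℕ) (K : ℝ) (F : ℝ → ℝ) (x : ℝ) : Prop :=
  ContDiffAt ℝ m F x ∧ ∀ i ≤ m, |iteratedDeriv i F x| ≤ K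

lemma wsp_open (m : ℕ) (F : ℝ → ℝ) (x : ℝ) (h : ContDiffAt ℝ m F x) :
    ∃ s : Set ℝ, IsOpen s ∧ x ∈ s ∧ ContDiffOn ℝ m F s := by
  obtain ⟨s, hs, ho, hx⟩ := eventually_nhds_iff.1 (h.eventually (by simp))
  exact ⟨s, ho, hx, fun y hy => (hs y hy).contDiffWithinAt⟩

lemma wsp_norm (i : ℕ) (F : ℝ → ℝ) (x : ℝ) (s : Set ℝ) (hs : IsOpen s) (hx : x ∈ s) :
    ‖iteratedFDerivWithin ℝ i F s x‖ = |iteratedDeriv i F x| := by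
  rw [iteratedFDerivWithin_of_isOpen i hs hx, norm_iteratedFDeriv_eq_norm_iteratedDeriv,
    Real.norm_eq_abs]

lemma WspBd.mono {m m' : ℕ} {K K' : ℝ} {F : ℝ → ℝ} {x : ℝ} (h : WspBd m K F x) (hm : m' ≤ m)
    (hK : K ≤ K') : WspBd m' K' F x :=
  ⟨h.1.of_le (by exact_mod_cast hm), fun i hi => (h.2 i (hi.trans hm)).trans hK⟩

lemma WspBd.congr {m : ℕ} {K : ℝ} {F G : ℝ → ℝ} {x : ℝ} (h : WspBd m K F x) (hG : G =ᶠ[𝓝 x] F) :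
    WspBd m K G x :=
  ⟨h.1.congr_of_eventuallyEq hG, fun i hi => by
    rw [hG.iteratedDeriv_eq i]; exact h.2 i hi⟩

lemma WspBd.nonneg {m : ℕ} {K : ℝ} {F : ℝ → ℝ} {x : ℝ} (h : WspBd m K F x) : 0 ≤ K :=
  (abs_nonneg _).trans (h.2 0 (Nat.zero_le _))

lemma WspBd.comp {m : ℕ} {A B : ℝ} {G F : ℝ → ℝ} {x : ℝ} (hG : WspBd m A G (F x))
    (hF : WspBd m B F x) : WspBd m (m.factorial * A * (max B 1) ^ m) (G ∘ F) x := by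
  have hcont : ContDiffAt ℝ m (G ∘ F) x := hG.1.comp x hF.1
  refine ⟨hcont, fun i hi => ?_⟩
  obtain ⟨t, ht, hxt, hGt⟩ := wsp_open m G (F x) hG.1
  obtain ⟨s, hs, hxs, hFs⟩ := wsp_open m F x hF.1
  have hso : IsOpen (s ∩ F ⁻¹' t) := hFs.continuousOn.isOpen_inter_preimage hs ht
  have hx : x ∈ s ∩ F ⁻¹' t := ⟨hxs, hxt⟩
  have key := norm_iteratedFDerivWithin_comp_le (n := i) (N := (m : ℕ∞)) (C := A) (D := max B 1)
    hGt (hFs.mono inter_subset_left) (by exact_mod_cast hi) ht.uniqueDiffOn hso.uniqueDiffOn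
    (fun y hy => hy.2) hx
    (fun j hj => by rw [wsp_norm _ _ _ _ ht hxt]; exact hG.2 j (hj.trans hi))
    (fun j hj1 hj => by
      rw [wsp_norm _ _ _ _ hso hx]
      calc _ ≤ B := hF.2 j (hj.trans hi)
        _ ≤ max B 1 := le_max_left _ _
        _ ≤ _ := le_self_pow₀ (le_max_right _ _) (by omega))
  rw [wsp_norm _ _ _ _ hso hx] at key
  refine key.trans ?_
  have hA := hG.nonneg
  have : (i.factorial : ℝ) ≤ m.factorial := by exact_mod_cast Nat.factorial_le hi
  have h2 : (max B 1) ^ i ≤ (max B 1) ^ m := pow_le_pow_right₀ (le_max_right _ _) hi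
  gcongr

lemma WspBd.mul {m : ℕ} {A B : ℝ} {G F : ℝ → ℝ} {x : ℝ} (hG : WspBd m A G x)
    (hF : WspBd m B F x) : WspBd m (2 ^ m * (A * B)) (fun y => G y * F y) x := by
  refine ⟨hG.1.mul hF.1, fun i hi => ?_⟩
  obtain ⟨t, ht, hxt, hGt⟩ := wsp_open m G x hG.1
  obtain ⟨s, hs, hxs, hFs⟩ := wsp_open m F x hF.1
  have hso : IsOpen (s ∩ t) := hs.inter ht
  have hx : x ∈ s ∩ t := ⟨hxs, hxt⟩
  have key := norm_iteratedFDerivWithin_mul_le (n := i) (N := (m : ℕ∞)) 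
    (hGt.mono inter_subset_right) (hFs.mono inter_subset_left) hso.uniqueDiffOn hx
    (by exact_mod_cast hi)
  simp only [wsp_norm _ _ _ _ hso hx] at key
  refine key.trans ?_
  have hA := hG.nonneg
  have hB := hF.nonneg
  calc _ ≤ ∑ j ∈ Finset.range (i + 1), (i.choose j : ℝ) * (A * B) := by
        refine Finset.sum_le_sum fun j hj => ?_
        rw [Finset.mem_range] at hj
        rw [mul_assoc]
        gcongr
        · exact hG.2 j (by omega)
        · exact hF.2 _ (by omega)
    _ = 2 ^ i * (A * B) := by
        rw [← Finset.sum_mul]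
        congr 1
        exact_mod_cast Nat.sum_range_choose i
    _ ≤ _ := by gcongr; norm_num

lemma wsp_exists_bd (m : ℕ) (F : ℝ → ℝ) (x : ℝ) (h : ContDiffAt ℝ m F x) :
    ∃ K, WspBd m K F x := by
  refine ⟨∑ i ∈ Finset.range (m + 1), |iteratedDeriv i F x|, h, fun i hi => ?_⟩
  exact Finset.single_le_sum (f := fun i => |iteratedDeriv i F x|) (fun _ _ => abs_nonneg _)
    (Finset.mem_range.2 (by omega))

lemma wsp_diff {m k : ℕ} {p : ℝ → ℝ} {x : ℝ} (hp : ContDiffAt ℝ m p x) (hk : k < m) :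
    DifferentiableAt ℝ (iteratedDeriv k p) x := by
  have h1 : ContDiffWithinAt ℝ m p univ x := hp
  have := h1.differentiableWithinAt_iteratedDerivWithin (m := k) (by exact_mod_cast hk)
    (by simp)
  rw [iteratedDerivWithin_univ] at this
  exact differentiableWithinAt_univ.1 this

/-- derivatives of `u * p u` -/
lemma wsp_iter_id_mul (j : ℕ) : ∀ (p : ℝ → ℝ) (x : ℝ) (_ : ContDiffAt ℝ (j + 1 : ℕ) p x),
    iteratedDeriv (j + 1) (fun u => u * p u) x =
      x * iteratedDeriv (j + 1) p x + (j + 1) * iteratedDeriv j p x := by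
  induction j with
  | zero =>
    intro p x hp
    have hd : DifferentiableAt ℝ p x := hp.differentiableAt (by simp)
    simp only [zero_add, iteratedDeriv_one, iteratedDeriv_zero, Nat.cast_zero, one_mul]
    have := ((hasDerivAt_id x).mul hd.hasDerivAt).deriv
    simp only [id] at this
    rw [show (fun u => u * p u) = (id * p) from rfl, this]; ring
  | succ j ih =>
    intro p x hp
    have he : ∀ᶠ y in 𝓝 x, ContDiffAt ℝ (j + 1 + 1 : ℕ) p y := hp.eventually (by simp)
    have e1 : iteratedDeriv (j + 1) (fun u => u * p u) =ᶠ[𝓝 x] fun y =>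
        y * iteratedDeriv (j + 1) p y + (j + 1) * iteratedDeriv j p y := by
      filter_upwards [he] with y hy
      exact ih p y (hy.of_le (by norm_cast; omega))
    rw [iteratedDeriv_succ, e1.deriv_eq]
    have d1 : DifferentiableAt ℝ (iteratedDeriv (j + 1) p) x :=
      wsp_diff hp (by omega)
    have d2 : DifferentiableAt ℝ (iteratedDeriv j p) x :=
      wsp_diff hp (by omega)
    have := (((hasDerivAt_id x).mul d1.hasDerivAt).add (d2.hasDerivAt.const_mul ((j:ℝ) + 1))).deriv
    simp only [id] at this
    refine Eq.trans this ?_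
    rw [iteratedDeriv_succ (n := j + 1), iteratedDeriv_succ (n := j)]
    push_cast; ring

/-- the autonomous equation `X' = φ ∘ X` -/
lemma wsp_ode (A : ℝ) (j : ℕ) : ∃ K, ∀ (φ X : ℝ → ℝ), WspBd j A φ 0 → X 0 = 0 →
    ContDiffAt ℝ (j + 1 : ℕ) X 0 → deriv X =ᶠ[𝓝 0] φ ∘ X → WspBd (j + 1) K X 0 := by
  induction j with
  | zero =>
    refine ⟨|A|, fun φ X hφ h0 hX hd => ⟨hX, fun i hi => ?_⟩⟩
    interval_cases i
    · simp [h0]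
    · have := hφ.2 0 le_rfl
      simp only [iteratedDeriv_zero] at this
      rw [iteratedDeriv_one, hd.self_of_nhds, Function.comp, h0]
      exact this.trans (le_abs_self _)
  | succ j ih =>
    obtain ⟨K, hK⟩ := ih
    refine ⟨max K ((j + 1).factorial * A * (max K 1) ^ (j + 1)),
      fun φ X hφ h0 hX hd => ⟨hX, fun i hi => ?_⟩⟩
    have hb := hK φ X (hφ.mono (by omega) le_rfl) h0 (hX.of_le (by norm_cast; omega)) hd
    rcases Nat.lt_or_ge i (j + 2) with h | h
    · exact (hb.2 i (by omega)).trans (le_max_left _ _)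
    · obtain rfl : i = j + 1 + 1 := by omega
      rw [iteratedDeriv_succ', hd.iteratedDeriv_eq]
      refine le_trans ?_ (le_max_right _ _)
      exact (WspBd.comp (by rwa [h0]) hb).2 _ le_rfl

lemma wsp_inverse (m : ℕ) (h : ℝ → ℝ) (hh : ContDiffAt ℝ (m + 1 : ℕ) h 0) (h0 : h 0 = 0)
    (h1 : deriv h 0 = 1) :
    ∃ X : ℝ → ℝ, X 0 = 0 ∧ ContDiffAt ℝ (m + 1 : ℕ) X 0 ∧ (∀ᶠ v in 𝓝 0, h (X v) = v) ∧
      deriv X =ᶠ[𝓝 0] (Inv.inv ∘ deriv h) ∘ X := by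
  have hd : HasDerivAt h 1 0 := by
    rw [← h1]; exact (hh.differentiableAt (by simp)).hasDerivAt
  have hf : HasFDerivAt h ((ContinuousLinearEquiv.refl ℝ ℝ : ℝ ≃L[ℝ] ℝ) : ℝ →L[ℝ] ℝ) 0 := by
    refine hd.hasFDerivAt.congr_fderiv ?_
    ext; simp
  have hn : ((m + 1 : ℕ) : WithTop ℕ∞) ≠ 0 := by simp
  have hX0 : hh.localInverse hf hn 0 = 0 := by
    have := hh.localInverse_apply_image hf hn
    rwa [h0] at this
  have hXc : ContDiffAt ℝ (m + 1 : ℕ) (hh.localInverse hf hn) 0 := by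
    have := hh.to_localInverse hf hn
    rwa [h0] at this
  have hr : ∀ᶠ v in 𝓝 0, h (hh.localInverse hf hn v) = v := by
    have := (hh.hasStrictFDerivAt' hf hn).eventually_right_inverse
    rwa [h0] at this
  refine ⟨hh.localInverse hf hn, hX0, hXc, hr, ?_⟩
  generalize hh.localInverse hf hn = X at *
  have hcX : Tendsto X (𝓝 0) (𝓝 0) := by
    have := hXc.continuousAt.tendsto
    rwa [hX0] at this
  have e1 := hXc.eventually (by simp)
  have e2 := hcX.eventually (hh.eventually (by simp))
  filter_upwards [e1, e2, hr.eventually_nhds] with v hv1 hv2 hv3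
  have a1 := (hv1.differentiableAt (by simp)).hasDerivAt
  have a2 := (hv2.differentiableAt (by simp)).hasDerivAt
  have a3 := a2.comp v a1
  have a4 : h ∘ X =ᶠ[𝓝 v] id := hv3
  have a5 := (a3.congr_of_eventuallyEq a4.symm).unique (hasDerivAt_id v)
  simp only [Function.comp]
  exact eq_inv_of_mul_eq_one_right a5

lemma wsp_core (m : ℕ) (B : ℝ) : ∃ K, ∀ F : ℝ → ℝ, ContDiffAt ℝ (m + 3 : ℕ) F 0 → F 0 = 0 →
    deriv F 0 = 0 → iteratedDeriv 2 F 0 = 2 →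
    (∀ r, 2 ≤ r → r ≤ m + 2 → |iteratedDeriv r F 0| ≤ B) →
    ∃ X : ℝ → ℝ, X 0 = 0 ∧ WspBd (m + 1) K X 0 ∧
      ∀ᶠ v in 𝓝 0, F (X v) = v ^ 2 ∧ (v < 0 → X v < 0) ∧ (0 < v → 0 < X v) := by
  obtain ⟨As, hAs⟩ := wsp_exists_bd m Real.sqrt 1 (Real.contDiffAt_sqrt one_ne_zero)
  obtain ⟨Ai, hAi⟩ := wsp_exists_bd m (Inv.inv : ℝ → ℝ) 1 (contDiffAt_inv ℝ one_ne_zero)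
  set A2 : ℝ := m.factorial * As * (max B 1) ^ m with hA2
  set A4 : ℝ := m.factorial * Ai * (max ((m + 1) * A2) 1) ^ m with hA4
  obtain ⟨K, hK⟩ := wsp_ode A4 m
  refine ⟨K, fun F hF hF0 hF1 hF2 hFB => ?_⟩
  obtain ⟨p, hp, hFp⟩ := wsp_hadamard (m + 2) F hF hF0
  have hpj : ∀ j ≤ m + 1, ((j : ℝ) + 1) * iteratedDeriv j p 0 = iteratedDeriv (j + 1) F 0 := by
    intro j hj
    rw [hFp.iteratedDeriv_eq, wsp_iter_id_mul j p 0 (hp.of_le (by norm_cast; omega))]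
    simp
  have hp0 : p 0 = 0 := by
    have := hpj 0 (by omega)
    simpa [hF1] using this
  obtain ⟨q, hq, hpq⟩ := wsp_hadamard (m + 1) p hp hp0
  have hqj : ∀ j ≤ m, ((j : ℝ) + 2) * (((j : ℝ) + 1) * iteratedDeriv j q 0) =
      iteratedDeriv (j + 2) F 0 := by
    intro j hj
    rw [← hpj (j + 1) (by omega), hpq.iteratedDeriv_eq,
      wsp_iter_id_mul j q 0 (hq.of_le (by norm_cast; omega))]
    push_cast; ring
  have hq0 : q 0 = 1 := by
    have := hqj 0 (by omega)
    simp only [zero_add, hF2] at this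
    simpa using this
  have hqB : WspBd m B q 0 := by
    refine ⟨hq.of_le (by norm_cast; omega), fun j hj => ?_⟩
    refine le_trans ?_ (hFB (j + 2) (by omega) (by omega))
    rw [← hqj j hj, abs_mul, abs_mul, abs_of_nonneg (by positivity : (0:ℝ) ≤ j + 2),
      abs_of_nonneg (by positivity : (0:ℝ) ≤ j + 1)]
    have hj0 : (0:ℝ) ≤ j := by positivity
    have := abs_nonneg (iteratedDeriv j q 0)
    nlinarith [mul_nonneg hj0 this, mul_nonneg hj0 (mul_nonneg hj0 this)]
  have hs : WspBd m A2 (Real.sqrt ∘ q) 0 := WspBd.comp (by rwa [hq0]) hqB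
  have hsc : ContDiffAt ℝ (m + 1 : ℕ) (Real.sqrt ∘ q) 0 :=
    ContDiffAt.comp 0 (Real.contDiffAt_sqrt (by simp [hq0])) hq
  have hs0 : (Real.sqrt ∘ q) 0 = 1 := by simp [hq0]
  generalize hsdef : Real.sqrt ∘ q = s at *
  let h : ℝ → ℝ := fun u => u * s u
  have hhc : ContDiffAt ℝ (m + 1 : ℕ) h 0 := contDiffAt_id.mul hsc
  have hhj : ∀ j ≤ m, iteratedDeriv (j + 1) h 0 = (j + 1) * iteratedDeriv j s 0 := by
    intro j hj
    rw [wsp_iter_id_mul j s 0 (hsc.of_le (by norm_cast; omega))]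
    simp
  have hh1 : deriv h 0 = 1 := by
    have := hhj 0 (by omega)
    simpa [hs0] using this
  have hh' : WspBd m ((m + 1) * A2) (deriv h) 0 := by
    refine ⟨hhc.derivWithin (by norm_cast), fun i hi => ?_⟩
    rw [← iteratedDeriv_succ', hhj i hi, abs_mul, abs_of_nonneg (by positivity : (0:ℝ) ≤ i + 1)]
    have h2 := hs.2 i hi
    have h3 : (i : ℝ) ≤ m := by exact_mod_cast hi
    gcongr
  have hφ : WspBd m A4 (Inv.inv ∘ deriv h) 0 := WspBd.comp (by rwa [hh1]) hh'
  obtain ⟨X, hX0, hXc, hXr, hXd⟩ := wsp_inverse m h hhc (by simp [h]) hh1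
  refine ⟨X, hX0, hK _ X hφ hX0 hXc hXd, ?_⟩
  have hcX : Tendsto X (𝓝 0) (𝓝 0) := by
    have := hXc.continuousAt.tendsto
    rwa [hX0] at this
  have hqpos : ∀ᶠ u in 𝓝 0, 0 < q u :=
    hq.continuousAt.eventually_const_lt (by rw [hq0]; norm_num)
  filter_upwards [hXr, hcX.eventually hFp, hcX.eventually hpq, hcX.eventually hqpos]
    with v h1 h2 h3 h4
  have hsp : s (X v) = Real.sqrt (q (X v)) := by rw [← hsdef]; rfl
  have hspos : 0 < s (X v) := by rw [hsp]; exact Real.sqrt_pos.2 h4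
  have hsq : s (X v) ^ 2 = q (X v) := by rw [hsp]; exact Real.sq_sqrt h4.le
  have h1' : X v * s (X v) = v := h1
  refine ⟨?_, fun hv => ?_, fun hv => ?_⟩
  · rw [h2, h3, ← hsq]
    calc _ = (X v * s (X v)) ^ 2 := by ring
      _ = _ := by rw [h1']
  · by_contra! hc
    nlinarith [mul_nonneg hc hspos.le]
  · by_contra! hc
    nlinarith [mul_nonneg (neg_nonneg.2 hc) hspos.le]

lemma wsp_mono (α β γ : ℝ) (f : ℝ → ℝ) (hα : α < γ) (hβ : γ < β)
    (hf : ContDiffOn ℝ 2 f (Icc α β)) (h0 : derivWithin f (Icc α β) γ = 0)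
    (h2 : ∀ x ∈ Icc α β, 0 < iteratedDerivWithin 2 f (Icc α β) x) :
    StrictMonoOn f (Icc γ β) ∧ StrictAntiOn f (Icc α γ) := by
  have hu : UniqueDiffOn ℝ (Icc α β) := uniqueDiffOn_Icc (hα.trans hβ)
  have hdc : ContinuousOn (derivWithin f (Icc α β)) (Icc α β) :=
    hf.continuousOn_derivWithin hu (by norm_num)
  have hd : StrictMonoOn (derivWithin f (Icc α β)) (Icc α β) := by
    apply strictMonoOn_of_deriv_pos (convex_Icc α β) hdc
    intro x hx
    rw [interior_Icc] at hx
    have := h2 x (Ioo_subset_Icc_self hx)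
    rw [iteratedDerivWithin_succ, derivWithin_of_mem_nhds (Icc_mem_nhds hx.1 hx.2)] at this
    have e : iteratedDerivWithin 1 f (Icc α β) =ᶠ[𝓝 x] derivWithin f (Icc α β) := by
      filter_upwards [Icc_mem_nhds hx.1 hx.2] with y hy
      simp
    rwa [e.deriv_eq] at this
  constructor
  · apply strictMonoOn_of_deriv_pos (convex_Icc γ β)
      (hf.continuousOn.mono (Icc_subset_Icc hα.le le_rfl))
    intro x hx
    rw [interior_Icc] at hx
    have hx' : x ∈ Icc α β := ⟨(hα.trans hx.1).le, hx.2.le⟩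
    have := hd ⟨hα.le, hβ.le⟩ hx' hx.1
    rwa [h0, derivWithin_of_mem_nhds (Icc_mem_nhds (hα.trans hx.1) hx.2)] at this
  · apply strictAntiOn_of_deriv_neg (convex_Icc α γ)
      (hf.continuousOn.mono (Icc_subset_Icc le_rfl hβ.le))
    intro x hx
    rw [interior_Icc] at hx
    have hx' : x ∈ Icc α β := ⟨hx.1.le, (hx.2.trans hβ).le⟩
    have := hd hx' ⟨hα.le, hβ.le⟩ hx.2
    rwa [h0, derivWithin_of_mem_nhds (Icc_mem_nhds hx.1 (hx.2.trans hβ))] at this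

lemma wsp_deriv_affine (f : ℝ → ℝ) (L γ : ℝ) :
    deriv (fun u => f (L * u + γ)) = fun u => L * deriv f (L * u + γ) := by
  ext u
  have := deriv_comp_mul_left L (fun x => f (x + γ)) u
  rw [this, deriv_comp_add_const]
  rfl

lemma wsp_affine (k : ℕ) (L γ : ℝ) : ∀ (f : ℝ → ℝ) (u : ℝ),
    iteratedDeriv k (fun u => f (L * u + γ)) u = L ^ k * iteratedDeriv k f (L * u + γ) := by
  induction k with
  | zero => intro f u; simp
  | succ k ih =>
    intro f u
    rw [iteratedDeriv_succ', wsp_deriv_affine, iteratedDeriv_const_mul_field, ih,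
      ← iteratedDeriv_succ']
    ring

lemma wsp_affine_sub (k : ℕ) (L γ c d : ℝ) (f : ℝ → ℝ) (u : ℝ) :
    iteratedDeriv (k + 1) (fun u => d * (f (L * u + γ) - c)) u =
      d * (L ^ (k + 1) * iteratedDeriv (k + 1) f (L * u + γ)) := by
  rw [iteratedDeriv_const_mul_field, ← wsp_affine, iteratedDeriv_succ', iteratedDeriv_succ']
  congr 2
  ext x
  exact deriv_sub_const _

/-- estimate (3.10) of the paper: under the phase and weight setup, the
Taylor coefficients `ϖ_k = G^{(k)}(0)/k!` of `G(y) = g(x(y))·x'(y)` satisfy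
`|ϖ_k| ≤ C U(1/N^k + 1/M^k)` for `1 ≤ k ≤ 2n`, with `C` depending only on `n` and
`C₀,…,C_{2n+3}`. -/
theorem weighted_stationary_phase_stmt12
    (n : ℕ) (hn : 2 ≤ n) (C : ℕ → ℝ) (hC : ∀ k, 0 < C k) :
    ∃ K : ℝ, 0 < K ∧
      ∀ (α β γ M N T U r1 r2 : ℝ) (f g xof : ℝ → ℝ),
        α < γ → γ < β → 0 < M → 0 < N → 0 < T → 0 < U → β - α ≤ M →
        ContDiffOn ℝ (2 * n + 3) f (Set.Icc α β) →
        ContDiffOn ℝ (2 * n + 1) g (Set.Icc α β) →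
        derivWithin f (Set.Icc α β) γ = 0 →
        (∀ r, 2 ≤ r → r ≤ 2 * n + 3 → ∀ x ∈ Set.Icc α β,
          |iteratedDerivWithin r f (Set.Icc α β) x| ≤ C r * T / M ^ r) →
        (∀ x ∈ Set.Icc α β,
          T / (C 2 * M ^ 2) ≤ iteratedDerivWithin 2 f (Set.Icc α β) x) →
        (∀ s, s ≤ 2 * n + 1 → ∀ x ∈ Set.Icc α β,
          |iteratedDerivWithin s g (Set.Icc α β) x| ≤ C s * U / N ^ s) →
        let lam2 : ℝ := iteratedDerivWithin 2 f (Set.Icc α β) γ / 2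
        0 < r1 → 0 < r2 →
        f α = f γ + lam2 * r1 ^ 2 →
        f β = f γ + lam2 * r2 ^ 2 →
        xof 0 = γ →
        (∀ y ∈ Set.Icc (-r1) r2, xof y ∈ Set.Icc α β ∧
          f (xof y) = f γ + lam2 * y ^ 2 ∧
          (y < 0 → xof y < γ) ∧ (0 < y → γ < xof y)) →
        let G : ℝ → ℝ := fun y => g (xof y) * derivWithin xof (Set.Icc (-r1) r2) y
        let ϖ : ℕ → ℝ := fun k =>
          iteratedDerivWithin k G (Set.Icc (-r1) r2) 0 / (Nat.factorial k : ℝ)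
        ∀ k, 1 ≤ k → k ≤ 2 * n → |ϖ k| ≤ K * U * (1 / N ^ k + 1 / M ^ k) := by
  set Cs : ℝ := ∑ i ∈ Finset.range (2 * n + 4), C i with hCs
  have hCi : ∀ i ≤ 2 * n + 3, C i ≤ Cs := fun i hi =>
    Finset.single_le_sum (f := C) (fun _ _ => (hC _).le) (Finset.mem_range.2 (by omega))
  have hCs0 : 0 < Cs := (hC 0).trans_le (hCi 0 (by omega))
  obtain ⟨K0, hK0⟩ := wsp_core (2 * n) (2 * C 2 * Cs)
  set K1 : ℝ := 2 ^ (2 * n) * (((2 * n).factorial * Cs * (max K0 1) ^ (2 * n)) * K0) with hK1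
  refine ⟨|K1| + 1, by positivity, ?_⟩
  intro α β γ M N T U r1 r2 f g xof hα hβ hM hN hT hU hβα hf hg hf1 hfB hfL hgB lam2 hr1 hr2
    _ _ hx0 hxof G ϖ k hk1 hk
  set L := min M N with hL
  have hLpos : 0 < L := lt_min hM hN
  have hLM : L ≤ M := min_le_left _ _
  have hLN : L ≤ N := min_le_right _ _
  have hγ : γ ∈ Icc α β := ⟨hα.le, hβ.le⟩
  have hnhds : Icc α β ∈ 𝓝 γ := Icc_mem_nhds hα hβ
  have hu : UniqueDiffOn ℝ (Icc α β) := uniqueDiffOn_Icc (hα.trans hβ)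
  have hfc : ContDiffOn ℝ (2 * n + 3 : ℕ) f (Icc α β) := by exact_mod_cast hf
  have hgc : ContDiffOn ℝ (2 * n + 1 : ℕ) g (Icc α β) := by exact_mod_cast hg
  have hfa : ContDiffAt ℝ (2 * n + 3 : ℕ) f γ := hfc.contDiffAt hnhds
  have hga : ContDiffAt ℝ (2 * n + 1 : ℕ) g γ := hgc.contDiffAt hnhds
  have hfi : ∀ r ≤ 2 * n + 3, iteratedDerivWithin r f (Icc α β) γ = iteratedDeriv r f γ :=
    fun r hr => iteratedDerivWithin_eq_iteratedDeriv hu (hfa.of_le (by norm_cast)) hγ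
  have hgi : ∀ r ≤ 2 * n + 1, iteratedDerivWithin r g (Icc α β) γ = iteratedDeriv r g γ :=
    fun r hr => iteratedDerivWithin_eq_iteratedDeriv hu (hga.of_le (by norm_cast)) hγ
  have hC2 := hC 2
  have hlow : 0 < T / (C 2 * M ^ 2) := by positivity
  have hlam : T / (C 2 * M ^ 2) ≤ 2 * lam2 := by
    have := hfL γ hγ
    simp only [lam2]; linarith
  have hlampos : 0 < lam2 := by linarith
  have hf2 : iteratedDeriv 2 f γ = 2 * lam2 := by
    rw [← hfi 2 (by omega)]; simp only [lam2]; ring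
  have hd1 : deriv f γ = 0 := by rw [← derivWithin_of_mem_nhds hnhds, hf1]
  obtain ⟨hmono, hanti⟩ := wsp_mono α β γ f hα hβ (hfc.of_le (by norm_cast; omega)) hf1
    (fun x hx => hlow.trans_le (hfL x hx))
  clear_value lam2
  have haff : ContDiff ℝ (⊤ : ℕ∞) (fun u : ℝ => L * u + γ) := by fun_prop
  have haff' : ∀ j : ℕ, ContDiffAt ℝ j (fun u : ℝ => L * u + γ) 0 := fun j => by fun_prop
  -- rescaled phase
  obtain ⟨X, hX0, hXB, hXe⟩ := hK0 (fun u => (lam2 * L ^ 2)⁻¹ * (f (L * u + γ) - f γ))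
    (by
      refine contDiffAt_const.mul (ContDiffAt.sub ?_ contDiffAt_const)
      exact ContDiffAt.comp (g := f) (0:ℝ) (by simpa using hfa) (haff' _))
    (by simp)
    (by
      have := wsp_affine_sub 0 L γ (f γ) (lam2 * L ^ 2)⁻¹ f 0
      simpa [hd1] using this)
    (by
      have := wsp_affine_sub 1 L γ (f γ) (lam2 * L ^ 2)⁻¹ f 0
      simp only [one_add_one_eq_two, mul_zero, zero_add, hf2] at this
      rw [this]; field_simp)
    (by
      intro r hr2 hr
      obtain ⟨j, rfl⟩ : ∃ j, r = j + 2 := ⟨r - 2, by omega⟩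
      rw [show j + 2 = (j + 1) + 1 from rfl, wsp_affine_sub]
      simp only [mul_zero, zero_add]
      have h1 := hfB (j + 2) (by omega) (by omega) γ hγ
      rw [hfi _ (by omega)] at h1
      have h2 : (L / M) ^ j ≤ 1 := pow_le_one₀ (by positivity) ((div_le_one hM).2 hLM)
      have h3 : lam2⁻¹ ≤ 2 * C 2 * M ^ 2 / T := by
        rw [div_le_iff₀ (by positivity)] at hlam
        rw [inv_le_comm₀ hlampos (by positivity), inv_div, div_le_iff₀ (by positivity)]
        linarith
      rw [abs_mul, abs_mul, abs_of_pos (by positivity : 0 < (lam2 * L ^ 2)⁻¹),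
        abs_of_pos (by positivity : 0 < L ^ (j + 1 + 1)), mul_inv]
      calc _ ≤ (2 * C 2 * M ^ 2 / T) * (L ^ 2)⁻¹ * (L ^ (j + 1 + 1) * (C (j + 2) * T / M ^ (j + 2))) := by
            gcongr
        _ = 2 * C 2 * C (j + 2) * (L / M) ^ j := by
            rw [div_pow]; field_simp; ring
        _ ≤ 2 * C 2 * Cs * 1 := by
            have := hCi (j + 2) (by omega)
            have := hC (j + 2)
            gcongr
        _ = _ := by ring)
  -- rescaled weight
  have hgt : WspBd (2 * n) Cs (fun u => U⁻¹ * g (L * u + γ)) (X 0) := by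
    rw [hX0]
    refine ⟨contDiffAt_const.mul (ContDiffAt.comp (g := g) (0:ℝ) ?_ (haff' _)), fun i hi => ?_⟩
    · simpa using hga.of_le (by norm_cast; omega)
    · rw [iteratedDeriv_const_mul_field, wsp_affine]
      simp only [mul_zero, zero_add]
      have h1 := hgB i (by omega) γ hγ
      rw [hgi _ (by omega)] at h1
      have h2 : (L / N) ^ i ≤ 1 := pow_le_one₀ (by positivity) ((div_le_one hN).2 hLN)
      rw [abs_mul, abs_mul, abs_of_pos (by positivity : 0 < U⁻¹),
        abs_of_pos (by positivity : 0 < L ^ i)]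
      calc _ ≤ U⁻¹ * (L ^ i * (C i * U / N ^ i)) := by gcongr
        _ = C i * (L / N) ^ i := by rw [div_pow]; field_simp
        _ ≤ Cs * 1 := by
            have := hCi i (by omega)
            have := hC i
            gcongr
        _ = _ := by ring
  have hX' : WspBd (2 * n) K0 (deriv X) 0 :=
    ⟨hXB.1.derivWithin (by norm_cast), fun i hi => by
      rw [← iteratedDeriv_succ']; exact hXB.2 _ (by omega)⟩
  have hGt := (hgt.comp (hXB.mono (by omega) le_rfl)).mul hX'
  rw [← hK1] at hGt
  -- identification of `xof`
  have hdiv : Tendsto (fun y : ℝ => L⁻¹ * y) (𝓝 0) (𝓝 0) := by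
    have : Continuous (fun y : ℝ => L⁻¹ * y) := by fun_prop
    simpa using this.tendsto 0
  have hXt : Tendsto (fun y => L * X (L⁻¹ * y) + γ) (𝓝 0) (𝓝 γ) := by
    have h1 : Tendsto X (𝓝 0) (𝓝 0) := by
      have := hXB.1.continuousAt.tendsto
      rwa [hX0] at this
    have := ((h1.comp hdiv).const_mul L).add_const γ
    simpa using this
  have hS : Icc (-r1) r2 ∈ 𝓝 (0:ℝ) := Icc_mem_nhds (by linarith) hr2
  have hxe : xof =ᶠ[𝓝 0] fun y => L * X (L⁻¹ * y) + γ := by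
    filter_upwards [hS, hdiv.eventually hXe, hXt.eventually hnhds] with y hy1 hy2 hy3
    obtain ⟨ha, hb, hc, hd⟩ := hxof y hy1
    obtain ⟨h1, h2, h3⟩ := hy2
    have hfe : f (xof y) = f (L * X (L⁻¹ * y) + γ) := by
      rw [hb]
      generalize f (L * X (L⁻¹ * y) + γ) = w at h1 ⊢
      field_simp at h1
      linarith
    rcases lt_trichotomy y 0 with h | h | h
    · have hh : L * X (L⁻¹ * y) < 0 :=
        mul_neg_of_pos_of_neg hLpos (h2 (mul_neg_of_pos_of_neg (by positivity) h))
      exact hanti.injOn ⟨ha.1, (hc h).le⟩ ⟨hy3.1, by linarith⟩ hfe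
    · subst h; simp [hx0, hX0]
    · have hh : 0 < L * X (L⁻¹ * y) := mul_pos hLpos (h3 (by positivity))
      exact hmono.injOn ⟨(hd h).le, ha.2⟩ ⟨by linarith, hy3.2⟩ hfe
  have hGe : G =ᶠ[𝓝 0] fun y => U * (fun v => ((fun u => U⁻¹ * g (L * u + γ)) ∘ X) v * deriv X v)
      (L⁻¹ * y + 0) := by
    filter_upwards [hxe.eventually_nhds, eventually_mem_nhds_iff.2 hS] with y hy hyS
    have e1 : xof y = L * X (L⁻¹ * y) + γ := hy.self_of_nhds
    have e2 : derivWithin xof (Icc (-r1) r2) y = deriv X (L⁻¹ * y) := by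
      have hy' : xof =ᶠ[𝓝 y] fun y => L * X (L⁻¹ * y) + γ := hy
      rw [derivWithin_of_mem_nhds hyS, hy'.deriv_eq, deriv_add_const, deriv_const_mul_field]
      have := deriv_comp_mul_left L⁻¹ X y
      rw [this, smul_eq_mul]
      field_simp
    simp only [G, e1, e2, Function.comp, add_zero]
    field_simp
  generalize (fun v => ((fun u => U⁻¹ * g (L * u + γ)) ∘ X) v * deriv X v) = H at hGt hGe
  have hGc : ContDiffAt ℝ k G 0 := by
    refine ContDiffAt.congr_of_eventuallyEq ?_ hGe
    refine contDiffAt_const.mul (ContDiffAt.comp (g := H) (0:ℝ) ?_ (by fun_prop))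
    simpa using hGt.1.of_le (by norm_cast)
  have hGk : iteratedDerivWithin k G (Icc (-r1) r2) 0 = U * (L⁻¹ ^ k * iteratedDeriv k H 0) := by
    rw [iteratedDerivWithin_eq_iteratedDeriv (uniqueDiffOn_Icc (by linarith)) hGc
      ⟨by linarith, hr2.le⟩, hGe.iteratedDeriv_eq, iteratedDeriv_const_mul_field, wsp_affine]
    simp
  have hLk : L⁻¹ ^ k ≤ 1 / N ^ k + 1 / M ^ k := by
    have h1 : 0 < 1 / N ^ k := by positivity
    have h2 : 0 < 1 / M ^ k := by positivity
    rw [inv_pow, ← one_div]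
    rcases min_choice M N with h | h
    · rw [hL, h]; linarith
    · rw [hL, h]; linarith
  have hHk : |iteratedDeriv k H 0| ≤ |K1| + 1 := by
    have := hGt.2 k hk
    linarith [le_abs_self K1]
  have hfac : (1:ℝ) ≤ k.factorial := by exact_mod_cast Nat.one_le_iff_ne_zero.2 k.factorial_ne_zero
  simp only [ϖ, hGk]
  rw [abs_div, abs_of_pos (by positivity : (0:ℝ) < k.factorial)]
  refine (div_le_self (abs_nonneg _) hfac).trans ?_
  rw [abs_mul, abs_mul, abs_of_pos hU, abs_of_pos (by positivity : 0 < L⁻¹ ^ k)]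
  calc _ ≤ U * ((1 / N ^ k + 1 / M ^ k) * (|K1| + 1)) := by gcongr
    _ = _ := by ring
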